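/- arXiv:2212.12267 — 2 statements merged into one kernel-verified Lean document; each statement's English description precedes it below -/
import Mathlib

section
/- On the two-dimensional phase space ℝ × ℝ, for every natural number n ≥ 1 one has the identity (q^n p^{n+1}) D_ω^{2n+1} (q^{2n} p^{2n+2}) = (−1)^{n+1} ((2n)! (2n+1)! (2n+2)!) / ((n−1)! (n+2)!) · q^{n−1} p^{n+2}. -/
/-- Partial derivative in the position variable `q` on phase space `ℝ × ℝ`. -/
noncomputable def dq1 (f : ℝ × ℝ → ℝ) : ℝ × ℝ → ℝ :=
  fun x => fderiv ℝ f x (1, 0)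

/-- Partial derivative in the momentum variable `p` on phase space `ℝ × ℝ`. -/
noncomputable def dp1 (f : ℝ × ℝ → ℝ) : ℝ × ℝ → ℝ :=
  fun x => fderiv ℝ f x (0, 1)

/-- Iterated bidifferential operator on `ℝ × ℝ`: `Dpow1 k f g = f D_ω^k g`, with
`f D_ω^0 g = f·g` and
`f D_ω^{k+1} g = (∂f/∂q) D_ω^k (∂g/∂p) − (∂f/∂p) D_ω^k (∂g/∂q)`. -/
noncomputable def Dpow1 : ℕ → (ℝ × ℝ → ℝ) → (ℝ × ℝ → ℝ) → ℝ × ℝ → ℝ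
  | 0, f, g => fun x => f x * g x
  | k + 1, f, g => fun x => Dpow1 k (dq1 f) (dp1 g) x - Dpow1 k (dp1 f) (dq1 g) x

theorem dq1_monomial (C : ℝ) (a b : ℕ) :
    dq1 (fun x => C * x.1 ^ a * x.2 ^ b) = fun x => C * a * x.1 ^ (a - 1) * x.2 ^ b := by
  funext x
  have h1 : HasFDerivAt (fun x : ℝ × ℝ => x.1) (ContinuousLinearMap.fst ℝ ℝ ℝ) x := hasFDerivAt_fst
  have h2 : HasFDerivAt (fun x : ℝ × ℝ => x.2) (ContinuousLinearMap.snd ℝ ℝ ℝ) x := hasFDerivAt_snd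
  have h := ((h1.pow a).const_mul C).mul (h2.pow b)
  refine (DFunLike.congr_fun h.fderiv _).trans ?_
  simp
  ring

theorem dp1_monomial (C : ℝ) (a b : ℕ) :
    dp1 (fun x => C * x.1 ^ a * x.2 ^ b) = fun x => C * b * x.1 ^ a * x.2 ^ (b - 1) := by
  funext x
  have h1 : HasFDerivAt (fun x : ℝ × ℝ => x.1) (ContinuousLinearMap.fst ℝ ℝ ℝ) x := hasFDerivAt_fst
  have h2 : HasFDerivAt (fun x : ℝ × ℝ => x.2) (ContinuousLinearMap.snd ℝ ℝ ℝ) x := hasFDerivAt_snd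
  have h := ((h1.pow a).const_mul C).mul (h2.pow b)
  refine (DFunLike.congr_fun h.fderiv _).trans ?_
  simp
  ring

theorem Dpow1_zero_left (k : ℕ) (g : ℝ × ℝ → ℝ) : Dpow1 k (fun _ => 0) g = fun _ => 0 := by
  induction k generalizing g with
  | zero => simp [Dpow1]
  | succ k ih =>
    have hq : dq1 (fun _ => 0) = fun _ => 0 := by funext x; simp [dq1]
    have hp : dp1 (fun _ => 0) = fun _ => 0 := by funext x; simp [dp1]
    simp [Dpow1, hq, hp, ih]

theorem cast_mul_descFactorial_pred (d a : ℕ) :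
    (d : ℝ) * ((d - 1).descFactorial a : ℝ) = (d.descFactorial (a + 1) : ℝ) := by
  cases d with
  | zero => simp
  | succ d => exact_mod_cast (Nat.succ_descFactorial_succ d a).symm

/-- When the order `k` equals the total degree of the left monomial, a single term of the binomial
expansion of `f D_ω^k g` survives. -/
theorem Dpow1_monomial {k a b : ℕ} (h : a + b = k) (C E : ℝ) (c d : ℕ) :
    Dpow1 k (fun x => C * x.1 ^ a * x.2 ^ b) (fun x => E * x.1 ^ c * x.2 ^ d)
      = fun x => C * E * (-1) ^ b * k.factorial * c.descFactorial b * d.descFactorial a *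
          x.1 ^ (c - b) * x.2 ^ (d - a) := by
  induction k generalizing a b C E c d with
  | zero =>
    obtain ⟨rfl, rfl⟩ : a = 0 ∧ b = 0 := by omega
    funext x
    simp [Dpow1]
    ring
  | succ k ih =>
    have hq : Dpow1 k (fun x => C * a * x.1 ^ (a - 1) * x.2 ^ b)
          (fun x => E * d * x.1 ^ c * x.2 ^ (d - 1))
        = fun x => a * (C * E * (-1) ^ b * k.factorial * c.descFactorial b * d.descFactorial a *
          x.1 ^ (c - b) * x.2 ^ (d - a)) := by
      cases a with
      | zero => simp [Dpow1_zero_left]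
      | succ a =>
        rw [Nat.add_sub_cancel, ih (by omega)]
        funext x
        rw [← cast_mul_descFactorial_pred d a, Nat.sub_sub, Nat.add_comm 1 a]
        ring
    have hp : Dpow1 k (fun x => C * b * x.1 ^ a * x.2 ^ (b - 1))
          (fun x => E * c * x.1 ^ (c - 1) * x.2 ^ d)
        = fun x => -(b * (C * E * (-1) ^ b * k.factorial * c.descFactorial b * d.descFactorial a *
          x.1 ^ (c - b) * x.2 ^ (d - a))) := by
      cases b with
      | zero => simp [Dpow1_zero_left]
      | succ b =>
        rw [Nat.add_sub_cancel, ih (by omega)]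
        funext x
        rw [← cast_mul_descFactorial_pred c b, Nat.sub_sub, Nat.add_comm 1 b]
        ring
    have hk : (k : ℝ) + 1 = a + b := by exact_mod_cast h.symm
    funext x
    simp only [Dpow1, dq1_monomial, dp1_monomial, hq, hp, Nat.factorial_succ]
    push_cast
    rw [hk]
    ring

/-- On phase space `ℝ × ℝ`, for every `n ≥ 1`,
`(q^n p^{n+1}) D_ω^{2n+1} (q^{2n} p^{2n+2})
  = (−1)^{n+1} (2n)!(2n+1)!(2n+2)! / ((n−1)!(n+2)!) · q^{n−1} p^{n+2}`. -/
theorem statement8 (n : ℕ) (hn : 1 ≤ n) :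
    Dpow1 (2 * n + 1) (fun x => x.1 ^ n * x.2 ^ (n + 1))
        (fun x => x.1 ^ (2 * n) * x.2 ^ (2 * n + 2))
      = fun x => (-1 : ℝ) ^ (n + 1) *
          ((Nat.factorial (2 * n) : ℝ) * (Nat.factorial (2 * n + 1) : ℝ) *
            (Nat.factorial (2 * n + 2) : ℝ)) /
          ((Nat.factorial (n - 1) : ℝ) * (Nat.factorial (n + 2) : ℝ)) *
          x.1 ^ (n - 1) * x.2 ^ (n + 2) := by
  have h := Dpow1_monomial (k := 2 * n + 1) (a := n) (b := n + 1) (by omega) 1 1 (2 * n) (2 * n + 2)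
  simp only [one_mul] at h
  rw [h]
  have hq : ((n - 1).factorial : ℝ) * (2 * n).descFactorial (n + 1) = (2 * n).factorial := by
    have := Nat.factorial_mul_descFactorial (show n + 1 ≤ 2 * n by omega)
    rw [show 2 * n - (n + 1) = n - 1 by omega] at this
    exact_mod_cast this
  have hp : ((n + 2).factorial : ℝ) * (2 * n + 2).descFactorial n = (2 * n + 2).factorial := by
    have := Nat.factorial_mul_descFactorial (show n ≤ 2 * n + 2 by omega)
    rw [show 2 * n + 2 - n = n + 2 by omega] at this
    exact_mod_cast this
  have hn1 : ((n - 1).factorial : ℝ) ≠ 0 := by positivity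
  have hn2 : ((n + 2).factorial : ℝ) ≠ 0 := by positivity
  funext x
  rw [← hq, ← hp, show 2 * n - (n + 1) = n - 1 by omega, show 2 * n + 2 - n = n + 2 by omega]
  field_simp
end

section
/- Let V be a smooth function on an open subset U of ℝ³, let H(q,p) = |p|²/(2μ) + V(q) and H_e(q,p) = c·q₃ for a real constant c, and let L_H f = ⟦H,f⟧ and L_{H_e} f = ⟦H_e,f⟧ denote the corresponding generalized-Moyal-bracket operators. Then for every smooth function f on U × ℝ³: L_{H_e} f = c·∂f/∂p₃, and the commutator satisfies (L_{H_e} L_H − L_H L_{H_e}) f = −(c/μ)·∂f/∂q₃ = L_G f, where G(q,p) = (c/μ)·p₃. -/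
/-- Partial derivative in the position variable `q i` on phase space `ℝ^N × ℝ^N`. -/
noncomputable def dq (N : ℕ) (i : Fin N) (f : (Fin N → ℝ) × (Fin N → ℝ) → ℝ) :
    (Fin N → ℝ) × (Fin N → ℝ) → ℝ :=
  fun x => fderiv ℝ f x (Pi.single i 1, 0)

/-- Partial derivative in the momentum variable `p i` on phase space `ℝ^N × ℝ^N`. -/
noncomputable def dp (N : ℕ) (i : Fin N) (f : (Fin N → ℝ) × (Fin N → ℝ) → ℝ) :
    (Fin N → ℝ) × (Fin N → ℝ) → ℝ :=
  fun x => fderiv ℝ f x (0, Pi.single i 1)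

/-- Iterated bidifferential operator: `Dpow N k f g = f D_ω^k g`, with
`f D_ω^0 g = f·g` and
`f D_ω^{k+1} g = ∑ i ((∂f/∂q_i) D_ω^k (∂g/∂p_i) − (∂f/∂p_i) D_ω^k (∂g/∂q_i))`. -/
noncomputable def Dpow (N : ℕ) : ℕ → ((Fin N → ℝ) × (Fin N → ℝ) → ℝ) →
    ((Fin N → ℝ) × (Fin N → ℝ) → ℝ) → (Fin N → ℝ) × (Fin N → ℝ) → ℝ
  | 0, f, g => fun x => f x * g x
  | k + 1, f, g => fun x =>
      ∑ i : Fin N, (Dpow N k (dq N i f) (dp N i g) x - Dpow N k (dp N i f) (dq N i g) x)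

/-- The generalized Moyal bracket `⟦f,g⟧ = ∑_{n=0}^{N₀} a_n ħ^{2n} (f D_ω^{2n+1} g)`,
where `hbar` plays the role of `ħ`. -/
noncomputable def gmb (N : ℕ) (a : ℕ → ℝ) (hbar : ℝ) (N₀ : ℕ)
    (f g : (Fin N → ℝ) × (Fin N → ℝ) → ℝ) : (Fin N → ℝ) × (Fin N → ℝ) → ℝ :=
  fun x => ∑ n ∈ Finset.range (N₀ + 1), a n * hbar ^ (2 * n) * Dpow N (2 * n + 1) f g x

section DirectionalDerivative

variable {E : Type*} [NormedAddCommGroup E] [NormedSpace ℝ E] {S : Set E} {f g : E → ℝ}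

lemma ContDiffOn.fderiv_apply_const (hS : IsOpen S) (hf : ContDiffOn ℝ (⊤ : ℕ∞) f S) (v : E) :
    ContDiffOn ℝ (⊤ : ℕ∞) (fun x => fderiv ℝ f x v) S :=
  (hf.fderiv_of_isOpen hS (by simp)).clm_apply contDiffOn_const

lemma Set.EqOn.fderiv_apply (hS : IsOpen S) (h : Set.EqOn f g S) (v : E) :
    Set.EqOn (fun x => fderiv ℝ f x v) (fun x => fderiv ℝ g x v) S := fun x hx => by
  have : f =ᶠ[nhds x] g := Filter.eventuallyEq_of_mem (hS.mem_nhds hx) h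
  simp only [this.fderiv_eq]

lemma ContDiffOn.differentiableAt_of_isOpen (hS : IsOpen S) (hf : ContDiffOn ℝ (⊤ : ℕ∞) f S)
    {x : E} (hx : x ∈ S) : DifferentiableAt ℝ f x :=
  (hf.contDiffAt (hS.mem_nhds hx)).differentiableAt (by simp)

lemma ContDiffOn.fderiv_fderiv_apply_comm (hS : IsOpen S) (hf : ContDiffOn ℝ (⊤ : ℕ∞) f S)
    (v w : E) :
    Set.EqOn (fun x => fderiv ℝ (fun y => fderiv ℝ f y v) x w)
      (fun x => fderiv ℝ (fun y => fderiv ℝ f y w) x v) S := fun x hx => by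
  have hc := hf.contDiffAt (hS.mem_nhds hx)
  have hd : DifferentiableAt ℝ (fderiv ℝ f) x :=
    (hc.fderiv_right (m := 1) (by norm_cast)).differentiableAt (by simp)
  have hsymm : IsSymmSndFDerivAt ℝ f x :=
    hc.isSymmSndFDerivAt (by simp [minSmoothness_of_isRCLikeNormedField]; norm_cast)
  simp only [fderiv_clm_apply hd (differentiableAt_const _), fderiv_fun_const]
  simpa using hsymm.eq w v

end DirectionalDerivative

section Dpow

variable {N : ℕ} {S : Set ((Fin N → ℝ) × (Fin N → ℝ))}

lemma Dpow_congr (hS : IsOpen S) (k : ℕ) {f f' g g' : (Fin N → ℝ) × (Fin N → ℝ) → ℝ}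
    (hf : Set.EqOn f f' S) (hg : Set.EqOn g g' S) :
    Set.EqOn (Dpow N k f g) (Dpow N k f' g') S := by
  induction k generalizing f f' g g' with
  | zero => intro x hx; simp only [Dpow, hf hx, hg hx]
  | succ k ih =>
    intro x hx
    simp only [Dpow]
    refine Finset.sum_congr rfl fun i _ => ?_
    exact congrArg₂ (· - ·) (ih (hf.fderiv_apply hS _) (hg.fderiv_apply hS _) hx)
      (ih (hf.fderiv_apply hS _) (hg.fderiv_apply hS _) hx)

lemma ContDiffOn.dpow (hS : IsOpen S) (k : ℕ) {f g : (Fin N → ℝ) × (Fin N → ℝ) → ℝ}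
    (hf : ContDiffOn ℝ (⊤ : ℕ∞) f S) (hg : ContDiffOn ℝ (⊤ : ℕ∞) g S) :
    ContDiffOn ℝ (⊤ : ℕ∞) (Dpow N k f g) S := by
  induction k generalizing f g with
  | zero => exact hf.mul hg
  | succ k ih =>
    exact ContDiffOn.sum fun i _ =>
      (ih (hf.fderiv_apply_const hS _) (hg.fderiv_apply_const hS _)).sub
        (ih (hf.fderiv_apply_const hS _) (hg.fderiv_apply_const hS _))

/-- Leibniz rule for constant-coefficient derivations and `Dpow`. -/
lemma fderiv_Dpow_apply (hS : IsOpen S) (k : ℕ) (v : (Fin N → ℝ) × (Fin N → ℝ))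
    {f g : (Fin N → ℝ) × (Fin N → ℝ) → ℝ}
    (hf : ContDiffOn ℝ (⊤ : ℕ∞) f S) (hg : ContDiffOn ℝ (⊤ : ℕ∞) g S)
    {x : (Fin N → ℝ) × (Fin N → ℝ)} (hx : x ∈ S) :
    fderiv ℝ (Dpow N k f g) x v =
      Dpow N k (fun y => fderiv ℝ f y v) g x + Dpow N k f (fun y => fderiv ℝ g y v) x := by
  induction k generalizing f g with
  | zero =>
    simp only [Dpow]
    rw [fderiv_fun_mul (hf.differentiableAt_of_isOpen hS hx) (hg.differentiableAt_of_isOpen hS hx)]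
    simp only [add_apply, smul_apply, smul_eq_mul]
    ring
  | succ k ih =>
    have hfd := fun w => hf.fderiv_apply_const hS w
    have hgd := fun w => hg.fderiv_apply_const hS w
    have term : ∀ w w', fderiv ℝ (Dpow N k (fun y => fderiv ℝ f y w) (fun y => fderiv ℝ g y w')) x v
        = Dpow N k (fun z => fderiv ℝ (fun y => fderiv ℝ f y v) z w) (fun y => fderiv ℝ g y w') x
        + Dpow N k (fun y => fderiv ℝ f y w) (fun z => fderiv ℝ (fun y => fderiv ℝ g y v) z w') x := by
      intro w w'
      rw [ih (hfd w) (hgd w'),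
        Dpow_congr hS k (hf.fderiv_fderiv_apply_comm hS w v) (Set.eqOn_refl _ _) hx,
        Dpow_congr hS k (Set.eqOn_refl _ _) (hg.fderiv_fderiv_apply_comm hS w' v) hx]
    have hd : ∀ w w', DifferentiableAt ℝ
        (Dpow N k (fun y => fderiv ℝ f y w) (fun y => fderiv ℝ g y w')) x := fun w w' =>
      ((hfd w).dpow hS k (hgd w')).differentiableAt_of_isOpen hS hx
    have hsum : fderiv ℝ (Dpow N (k + 1) f g) x = ∑ i : Fin N,
        (fderiv ℝ (Dpow N k (dq N i f) (dp N i g)) x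
          - fderiv ℝ (Dpow N k (dp N i f) (dq N i g)) x) := by
      simp only [Dpow]
      unfold dq dp
      rw [fderiv_fun_sum fun i _ => (hd _ _).fun_sub (hd _ _)]
      exact Finset.sum_congr rfl fun i _ => fderiv_fun_sub (hd _ _) (hd _ _)
    rw [hsum]
    simp only [Dpow, sum_apply, sub_apply, ← Finset.sum_add_distrib]
    refine Finset.sum_congr rfl fun i _ => ?_
    unfold dq dp
    rw [term, term]
    ring

lemma Dpow_zero_left (k : ℕ) (g : (Fin N → ℝ) × (Fin N → ℝ) → ℝ) :
    Dpow N k (fun _ => 0) g = fun _ => 0 := by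
  induction k generalizing g with
  | zero => simp [Dpow]
  | succ k ih =>
    have hq : ∀ i, dq N i (fun _ => 0) = fun _ => 0 := fun i => by ext; simp [dq]
    have hp : ∀ i, dp N i (fun _ => 0) = fun _ => 0 := fun i => by ext; simp [dp]
    simp [Dpow, hq, hp, ih]

lemma Dpow_succ_const_left (k : ℕ) (b : ℝ) (g : (Fin N → ℝ) × (Fin N → ℝ) → ℝ) :
    Dpow N (k + 1) (fun _ => b) g = fun _ => 0 := by
  have hq : ∀ i, dq N i (fun _ => b) = fun _ => 0 := fun i => by ext; simp [dq]
  have hp : ∀ i, dp N i (fun _ => b) = fun _ => 0 := fun i => by ext; simp [dp]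
  simp [Dpow, hq, hp, Dpow_zero_left]

lemma Dpow_const_mul_right (k : ℕ) (b : ℝ) (f g : (Fin N → ℝ) × (Fin N → ℝ) → ℝ) :
    Dpow N k f (fun y => b * g y) = fun x => b * Dpow N k f g x := by
  have hder : ∀ (g : (Fin N → ℝ) × (Fin N → ℝ) → ℝ) x v,
      fderiv ℝ (fun y => b * g y) x v = b * fderiv ℝ g x v := fun g x v => by
    exact congrArg (fun L => L v) (congrFun (fderiv_const_smul_field (𝕜 := ℝ) (f := g) b) x)
  induction k generalizing f g with
  | zero => funext x; simp only [Dpow]; ring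
  | succ k ih =>
    funext x
    have hq : ∀ i, dq N i (fun y => b * g y) = fun x => b * dq N i g x := fun i =>
      funext fun x => hder g x _
    have hp : ∀ i, dp N i (fun y => b * g y) = fun x => b * dp N i g x := fun i =>
      funext fun x => hder g x _
    simp only [Dpow, hq, hp, ih, Finset.mul_sum, mul_sub]

end Dpow

section gmb

variable {N : ℕ} {S : Set ((Fin N → ℝ) × (Fin N → ℝ))} (a : ℕ → ℝ) (hbar : ℝ) (N₀ : ℕ)

/-- If `h` is affine, only the Poisson bracket term of `⟦h, g⟧` survives. -/
lemma gmb_of_const_derivs (ha0 : a 0 = 1) {h : (Fin N → ℝ) × (Fin N → ℝ) → ℝ} (α β : Fin N → ℝ)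
    (hq : ∀ i, dq N i h = fun _ => α i) (hp : ∀ i, dp N i h = fun _ => β i)
    (g : (Fin N → ℝ) × (Fin N → ℝ) → ℝ) :
    gmb N a hbar N₀ h g = fun x => ∑ i, (α i * dp N i g x - β i * dq N i g x) := by
  funext x
  unfold gmb
  rw [Finset.sum_eq_single 0]
  · simp [Dpow, hq, hp, ha0]
  · intro n _ hn
    obtain ⟨m, rfl⟩ := Nat.exists_eq_succ_of_ne_zero hn
    rw [show 2 * (m + 1) + 1 = (2 * m + 1) + 1 + 1 by ring, Dpow]
    simp [hq, hp, Dpow_succ_const_left]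
  · simp

lemma gmb_mul_coord_fst (ha0 : a 0 = 1) (c : ℝ) (j : Fin N)
    (g : (Fin N → ℝ) × (Fin N → ℝ) → ℝ) :
    gmb N a hbar N₀ (fun y => c * y.1 j) g = fun x => c * dp N j g x := by
  let L : (Fin N → ℝ) × (Fin N → ℝ) →L[ℝ] ℝ :=
    c • (ContinuousLinearMap.proj j ∘L ContinuousLinearMap.fst ℝ _ _)
  have hL : ∀ x, fderiv ℝ (fun y : (Fin N → ℝ) × (Fin N → ℝ) => c * y.1 j) x = L := fun x =>
    L.fderiv
  rw [gmb_of_const_derivs a hbar N₀ ha0 (fun i => if i = j then c else 0) (fun _ => 0)]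
  · simp
  · intro i; funext x; simp [dq, hL, L, Pi.single_apply, eq_comm]
  · intro i; funext x; simp [dp, hL, L]

lemma gmb_mul_coord_snd (ha0 : a 0 = 1) (c : ℝ) (j : Fin N)
    (g : (Fin N → ℝ) × (Fin N → ℝ) → ℝ) :
    gmb N a hbar N₀ (fun y => c * y.2 j) g = fun x => -c * dq N j g x := by
  let L : (Fin N → ℝ) × (Fin N → ℝ) →L[ℝ] ℝ :=
    c • (ContinuousLinearMap.proj j ∘L ContinuousLinearMap.snd ℝ _ _)
  have hL : ∀ x, fderiv ℝ (fun y : (Fin N → ℝ) × (Fin N → ℝ) => c * y.2 j) x = L := fun x =>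
    L.fderiv
  rw [gmb_of_const_derivs a hbar N₀ ha0 (fun _ => 0) (fun i => if i = j then c else 0)]
  · simp
  · intro i; funext x; simp [dq, hL, L]
  · intro i; funext x; simp [dp, hL, L, Pi.single_apply, eq_comm]

lemma gmb_const_mul_right (b : ℝ) (f g : (Fin N → ℝ) × (Fin N → ℝ) → ℝ) :
    gmb N a hbar N₀ f (fun y => b * g y) = fun x => b * gmb N a hbar N₀ f g x := by
  funext x
  simp only [gmb, Dpow_const_mul_right, Finset.mul_sum]
  exact Finset.sum_congr rfl fun n _ => by ring

lemma gmb_congr_left (hS : IsOpen S) {f f' : (Fin N → ℝ) × (Fin N → ℝ) → ℝ}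
    (hf : Set.EqOn f f' S) (g : (Fin N → ℝ) × (Fin N → ℝ) → ℝ) :
    Set.EqOn (gmb N a hbar N₀ f g) (gmb N a hbar N₀ f' g) S := fun x hx => by
  simp only [gmb, Dpow_congr hS _ hf (Set.eqOn_refl g S) hx]

lemma dp_gmb (hS : IsOpen S) (j : Fin N) {f g : (Fin N → ℝ) × (Fin N → ℝ) → ℝ}
    (hf : ContDiffOn ℝ (⊤ : ℕ∞) f S) (hg : ContDiffOn ℝ (⊤ : ℕ∞) g S)
    {x : (Fin N → ℝ) × (Fin N → ℝ)} (hx : x ∈ S) :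
    dp N j (gmb N a hbar N₀ f g) x =
      gmb N a hbar N₀ (dp N j f) g x + gmb N a hbar N₀ f (dp N j g) x := by
  have hd : ∀ k, DifferentiableAt ℝ (Dpow N k f g) x := fun k =>
    (hf.dpow hS k hg).differentiableAt_of_isOpen hS hx
  unfold gmb
  rw [dp, fderiv_fun_sum fun n _ => (hd _).const_mul _]
  simp only [sum_apply, ← Finset.sum_add_distrib]
  refine Finset.sum_congr rfl fun n _ => ?_
  rw [fderiv_const_mul (hd _), smul_apply, fderiv_Dpow_apply hS _ _ hf hg hx,
    smul_eq_mul, mul_add]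
  rfl

end gmb

/-- The momentum derivative of a mechanical Hamiltonian is the velocity. -/
lemma dp_kinetic_add_potential {N : ℕ} (mu : ℝ) {V : (Fin N → ℝ) → ℝ} (j : Fin N)
    {x : (Fin N → ℝ) × (Fin N → ℝ)} (hV : DifferentiableAt ℝ V x.1) :
    dp N j (fun y => (∑ i : Fin N, (y.2 i) ^ 2) / (2 * mu) + V y.1) x = (1 / mu) * x.2 j := by
  have hpi : ∀ i : Fin N, HasFDerivAt (fun y : (Fin N → ℝ) × (Fin N → ℝ) => y.2 i)
      (ContinuousLinearMap.proj i ∘L ContinuousLinearMap.snd ℝ (Fin N → ℝ) (Fin N → ℝ)) x :=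
    fun i => (ContinuousLinearMap.proj i ∘L
      ContinuousLinearMap.snd ℝ (Fin N → ℝ) (Fin N → ℝ)).hasFDerivAt
  have hT := (HasFDerivAt.fun_sum (u := Finset.univ) fun i _ => (hpi i).pow 2).mul_const
    (2 * mu)⁻¹
  have hW : HasFDerivAt (fun y : (Fin N → ℝ) × (Fin N → ℝ) => V y.1)
      (fderiv ℝ V x.1 ∘L ContinuousLinearMap.fst ℝ _ _) x :=
    hV.hasFDerivAt.comp x hasFDerivAt_fst
  have h := hT.add hW
  simp only [dp, div_eq_mul_inv]
  erw [h.fderiv]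
  simp [Pi.single_apply]
  ring

/-- For `H(q,p) = |p|²/(2μ) + V(q)` with `V` smooth on an open `U ⊆ ℝ³`, and
`H_e(q,p) = c·q₃`, at every point with `q ∈ U` one has `L_{H_e} f = c ∂f/∂p₃` and
`(L_{H_e} L_H − L_H L_{H_e}) f = −(c/μ) ∂f/∂q₃ = L_G f` for `G(q,p) = (c/μ) p₃`,
where `L_h f = ⟦h,f⟧` is the generalized-Moyal-bracket operator. -/
theorem statement18 (mu : ℝ) (hmu : 0 < mu) (hbar : ℝ) (hhbar : 0 < hbar)
    (a : ℕ → ℝ) (N₀ : ℕ) (ha0 : a 0 = 1) (haN : ∀ k, N₀ < k → a k = 0)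
    (U : Set (Fin 3 → ℝ)) (hU : IsOpen U)
    (V : (Fin 3 → ℝ) → ℝ) (hV : ContDiffOn ℝ (⊤ : ℕ∞) V U) (c : ℝ)
    (f : (Fin 3 → ℝ) × (Fin 3 → ℝ) → ℝ) (hf : ContDiffOn ℝ (⊤ : ℕ∞) f (U ×ˢ Set.univ)) :
    ∀ x : (Fin 3 → ℝ) × (Fin 3 → ℝ), x.1 ∈ U →
      gmb 3 a hbar N₀ (fun y => c * y.1 2) f x = c * dp 3 2 f x ∧
      gmb 3 a hbar N₀ (fun y => c * y.1 2)
          (gmb 3 a hbar N₀ (fun y => (∑ i : Fin 3, (y.2 i) ^ 2) / (2 * mu) + V y.1) f) x -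
        gmb 3 a hbar N₀ (fun y => (∑ i : Fin 3, (y.2 i) ^ 2) / (2 * mu) + V y.1)
          (gmb 3 a hbar N₀ (fun y => c * y.1 2) f) x
        = -(c / mu) * dq 3 2 f x ∧
      gmb 3 a hbar N₀ (fun y => (c / mu) * y.2 2) f x = -(c / mu) * dq 3 2 f x := by
  intro x hx
  have hS : IsOpen (U ×ˢ (Set.univ : Set (Fin 3 → ℝ))) := hU.prod isOpen_univ
  have hxS : x ∈ U ×ˢ (Set.univ : Set (Fin 3 → ℝ)) := ⟨hx, trivial⟩
  have hH : ContDiffOn ℝ (⊤ : ℕ∞) (fun y : (Fin 3 → ℝ) × (Fin 3 → ℝ) =>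
      (∑ i : Fin 3, (y.2 i) ^ 2) / (2 * mu) + V y.1) (U ×ˢ Set.univ) := by
    refine ContDiffOn.add (ContDiff.contDiffOn (by fun_prop)) ?_
    exact hV.comp contDiff_fst.contDiffOn fun y hy => hy.1
  have hdpH : Set.EqOn (dp 3 2 fun y => (∑ i : Fin 3, (y.2 i) ^ 2) / (2 * mu) + V y.1)
      (fun y => (1 / mu) * y.2 2) (U ×ˢ Set.univ) := fun y hy =>
    dp_kinetic_add_potential mu 2 (hV.differentiableAt_of_isOpen hU hy.1)
  refine ⟨by rw [gmb_mul_coord_fst a hbar N₀ ha0], ?_, by rw [gmb_mul_coord_snd a hbar N₀ ha0]⟩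
  rw [gmb_mul_coord_fst a hbar N₀ ha0, gmb_mul_coord_fst a hbar N₀ ha0, gmb_const_mul_right]
  beta_reduce
  rw [dp_gmb a hbar N₀ hS 2 hH hf hxS, gmb_congr_left a hbar N₀ hS hdpH f hxS,
    gmb_mul_coord_snd a hbar N₀ ha0]
  ring
end
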